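/- arXiv:2402.03218 — 3 statements merged into one kernel-verified Lean document; each statement's English description precedes it below -/
import Mathlib

section
/- For every z ∈ ℂ with Re z > 1 + 1/d, the integral M(z) = ∫₀^∞ e^{-kz} μ(e^{-k}) dk converges absolutely and M(z) = 2^{d/2} π^{(d+1)/2} z^{-d/2-1} · Γ((d/2)(z-1) - 1/2) / Γ((d/2)(z-1)), where Γ denotes the complex Gamma function. -/
open MeasureTheory
open scoped BigOperators

/-- The Gaussian space-time weight `w(t,x) = (1+t²)^{-d/2} exp(-|x|²/(2(1+t²)))`. -/
noncomputable def gaussWeight (d : ℕ) (p : ℝ × (Fin d → ℝ)) : ℝ :=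
  (1 + p.1 ^ 2) ^ (-(d : ℝ) / 2) *
    Real.exp (-(∑ j, p.2 j ^ 2) / (2 * (1 + p.1 ^ 2)))

/-- The distribution function `μ(λ) = |{(t,x) : w(t,x) > λ}|`. -/
noncomputable def gaussDist (d : ℕ) (l : ℝ) : ℝ :=
  (volume {p : ℝ × (Fin d → ℝ) | l < gaussWeight d p}).toReal

/-- `M(z) = ∫₀^∞ e^{-kz} μ(e^{-k}) dk`. -/
noncomputable def M (d : ℕ) (z : ℂ) : ℂ :=
  ∫ k in Set.Ioi (0 : ℝ),
    Complex.exp (-(k : ℂ) * z) * (gaussDist d (Real.exp (-k)) : ℂ)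

theorem sqrt_pow_eq_rpow {u : ℝ} (hu : 0 ≤ u) (d : ℕ) : √u ^ d = u ^ ((d : ℝ) / 2) := by
  rw [Real.sqrt_eq_rpow, ← Real.rpow_natCast, ← Real.rpow_mul hu]
  congr 1; ring

theorem sqrt_pow_eq_zero {d : ℕ} (hd : 1 ≤ d) {u : ℝ} (hu : u ≤ 0) : √u ^ d = 0 := by
  rw [Real.sqrt_eq_zero_of_nonpos hu, zero_pow (by omega)]

theorem integrable_exp_neg_mul_sqrt_pow {d : ℕ} (hd : 1 ≤ d) {z : ℂ} (hz : 0 < z.re) :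
    Integrable fun u : ℝ => Complex.exp (-(u : ℂ) * z) * ((√u ^ d : ℝ) : ℂ) := by
  rw [← integrableOn_iff_integrable_of_support_subset (s := Set.Ioi 0)]
  · have h := integrableOn_rpow_mul_exp_neg_mul_rpow (p := 1) (s := (d : ℝ) / 2) (b := z.re)
      (by have : (0 : ℝ) ≤ d := by positivity
          linarith) one_pos hz
    refine Integrable.mono' h (Continuous.aestronglyMeasurable (by fun_prop)) ?_
    refine (ae_restrict_iff' measurableSet_Ioi).2 (.of_forall fun u hu => ?_)
    rw [norm_mul, Complex.norm_exp, Complex.norm_real, Real.norm_of_nonneg (by positivity),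
      sqrt_pow_eq_rpow (le_of_lt hu), mul_comm]
    simp [mul_comm]
  · intro u hu
    by_contra h
    exact hu (by simp [sqrt_pow_eq_zero hd (not_lt.1 h)])

theorem integral_exp_neg_mul_sqrt_pow_of_pos {d : ℕ} (hd : 1 ≤ d) {r : ℝ} (hr : 0 < r) :
    ∫ u : ℝ, Complex.exp (-(u : ℂ) * r) * ((√u ^ d : ℝ) : ℂ) =
      (r : ℂ) ^ (-(d : ℂ) / 2 - 1) * Complex.Gamma ((d : ℂ) / 2 + 1) := by
  rw [← setIntegral_eq_integral_of_forall_compl_eq_zero (s := Set.Ioi (0 : ℝ))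
    fun u hu => by simp [sqrt_pow_eq_zero hd (not_lt.1 hu)]]
  have h := Complex.integral_cpow_mul_exp_neg_mul_Ioi (a := (d : ℂ) / 2 + 1)
    (by simp; positivity) hr
  rw [show -(d : ℂ) / 2 - 1 = -((d : ℂ) / 2 + 1) by ring, Complex.cpow_neg,
    ← Complex.inv_cpow _ _ (by
      rw [Complex.arg_ofReal_of_nonneg hr.le]; exact Real.pi_pos.ne), ← one_div, ← h]
  refine setIntegral_congr_fun measurableSet_Ioi fun u hu => ?_
  simp only [sqrt_pow_eq_rpow (le_of_lt hu)]
  rw [Complex.ofReal_cpow (le_of_lt hu), mul_comm]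
  congr 2
  · push_cast; ring
  · ring

theorem differentiableAt_integral_exp_neg_mul_sqrt_pow {d : ℕ} (hd : 1 ≤ d) {z : ℂ}
    (hz : 0 < z.re) :
    DifferentiableAt ℂ (fun w : ℂ => ∫ u : ℝ, Complex.exp (-(u : ℂ) * w) * ((√u ^ d : ℝ) : ℂ))
      z := by
  have hs : {w : ℂ | z.re / 2 < w.re} ∈ nhds z :=
    (isOpen_lt continuous_const Complex.continuous_re).mem_nhds (half_lt_self hz)
  have hb := (integrable_exp_neg_mul_sqrt_pow (d := d + 2) (by omega)
    (z := ((z.re / 2 : ℝ) : ℂ)) (by simpa using hz)).norm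
  refine (hasDerivAt_integral_of_dominated_loc_of_deriv_le
    (F := fun (w : ℂ) (u : ℝ) => Complex.exp (-(u : ℂ) * w) * ((√u ^ d : ℝ) : ℂ))
    (F' := fun (w : ℂ) (u : ℝ) => Complex.exp (-(u : ℂ) * w) * (-(u : ℂ)) * ((√u ^ d : ℝ) : ℂ)) hs
    (.of_forall fun w => Continuous.aestronglyMeasurable (by fun_prop))
    (integrable_exp_neg_mul_sqrt_pow hd hz)
    (Continuous.aestronglyMeasurable (by fun_prop)) (.of_forall fun u w hw => ?_) hb
    (.of_forall fun u w _ => ?_)).2.differentiableAt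
  · rcases le_or_gt u 0 with hu | hu
    · simp [sqrt_pow_eq_zero hd hu]
    · have hw : z.re / 2 < w.re := hw
      rw [norm_mul, norm_mul, norm_mul, norm_neg, Complex.norm_exp, Complex.norm_exp,
        Complex.norm_real, Complex.norm_real, Complex.norm_real, Real.norm_of_nonneg hu.le,
        Real.norm_of_nonneg (by positivity), Real.norm_of_nonneg (by positivity), pow_add,
        Real.sq_sqrt hu.le, mul_assoc, mul_comm u, ← Complex.ofReal_neg, Complex.re_ofReal_mul,
        Complex.re_ofReal_mul, Complex.ofReal_re]
      gcongr ?_ * _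
      exact Real.exp_le_exp.2 (by nlinarith)
  · simpa using (((hasDerivAt_id w).const_mul (-(u : ℂ))).cexp).mul_const ((√u ^ d : ℝ) : ℂ)

theorem integral_exp_neg_mul_sqrt_pow {d : ℕ} (hd : 1 ≤ d) {z : ℂ} (hz : 0 < z.re) :
    ∫ u : ℝ, Complex.exp (-(u : ℂ) * z) * ((√u ^ d : ℝ) : ℂ) =
      z ^ (-(d : ℂ) / 2 - 1) * Complex.Gamma ((d : ℂ) / 2 + 1) := by
  have ho : IsOpen {w : ℂ | 0 < w.re} := isOpen_lt continuous_const Complex.continuous_re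
  have hL : AnalyticOnNhd ℂ
      (fun w : ℂ => ∫ u : ℝ, Complex.exp (-(u : ℂ) * w) * ((√u ^ d : ℝ) : ℂ))
      {w : ℂ | 0 < w.re} :=
    DifferentiableOn.analyticOnNhd (fun w hw =>
      (differentiableAt_integral_exp_neg_mul_sqrt_pow hd hw).differentiableWithinAt) ho
  have hR : AnalyticOnNhd ℂ
      (fun w : ℂ => w ^ (-(d : ℂ) / 2 - 1) * Complex.Gamma ((d : ℂ) / 2 + 1))
      {w : ℂ | 0 < w.re} :=
    DifferentiableOn.analyticOnNhd (fun w hw =>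
      ((differentiableAt_id.cpow_const (Or.inl hw)).mul_const _).differentiableWithinAt) ho
  refine hL.eqOn_of_preconnected_of_frequently_eq hR
    (convex_halfSpace_re_gt 0).isPreconnected (z₀ := 1) (by simp) ?_ hz
  have ht : Filter.Tendsto (fun r : ℝ => (r : ℂ)) (nhdsWithin 1 {1}ᶜ) (nhdsWithin 1 {1}ᶜ) := by
    refine tendsto_nhdsWithin_iff.2 ⟨?_, ?_⟩
    · exact (Complex.continuous_ofReal.tendsto' 1 1 (by simp)).mono_left nhdsWithin_le_nhds
    · filter_upwards [self_mem_nhdsWithin] with r hr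
      simpa using hr
  refine ht.frequently (Filter.Eventually.frequently ?_)
  filter_upwards [nhdsWithin_le_nhds (Ioi_mem_nhds one_pos)] with r hr
  exact integral_exp_neg_mul_sqrt_pow_of_pos hd hr

theorem exp_neg_mul_sqrt_sub_pow (d : ℕ) (z : ℂ) (a k : ℝ) :
    Complex.exp (-(k : ℂ) * z) * ((√(k - a) ^ d : ℝ) : ℂ) =
      Complex.exp (-(a : ℂ) * z) *
        (Complex.exp (-((k - a : ℝ) : ℂ) * z) * ((√(k - a) ^ d : ℝ) : ℂ)) := by
  rw [← mul_assoc, ← Complex.exp_add]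
  congr 2
  push_cast; ring

theorem integrable_exp_neg_mul_sqrt_sub_pow {d : ℕ} (hd : 1 ≤ d) {z : ℂ} (hz : 0 < z.re)
    (a : ℝ) :
    Integrable fun k : ℝ => Complex.exp (-(k : ℂ) * z) * ((√(k - a) ^ d : ℝ) : ℂ) := by
  simp_rw [exp_neg_mul_sqrt_sub_pow d z a]
  exact ((integrable_exp_neg_mul_sqrt_pow hd hz).comp_sub_right a).const_mul _

theorem setIntegral_exp_neg_mul_sqrt_sub_pow {d : ℕ} (hd : 1 ≤ d) {z : ℂ} (hz : 0 < z.re)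
    {a : ℝ} (ha : 0 ≤ a) :
    ∫ k in Set.Ioi (0 : ℝ), Complex.exp (-(k : ℂ) * z) * ((√(k - a) ^ d : ℝ) : ℂ) =
      Complex.exp (-(a : ℂ) * z) *
        (z ^ (-(d : ℂ) / 2 - 1) * Complex.Gamma ((d : ℂ) / 2 + 1)) := by
  rw [setIntegral_eq_integral_of_forall_compl_eq_zero fun k hk => by
    have : k ≤ 0 := not_lt.1 hk
    simp [sqrt_pow_eq_zero hd (show k - a ≤ 0 by linarith)]]
  simp_rw [exp_neg_mul_sqrt_sub_pow d z a]
  rw [integral_const_mul,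
    integral_sub_right_eq_self (fun u : ℝ => Complex.exp (-(u : ℂ) * z) * ((√u ^ d : ℝ) : ℂ)),
    integral_exp_neg_mul_sqrt_pow hd hz]

theorem integrable_one_add_sq_cpow_neg {s : ℂ} (hs : 1 / 2 < s.re) :
    Integrable fun t : ℝ => ((1 + t ^ 2 : ℝ) : ℂ) ^ (-s) := by
  have h := integrable_rpow_neg_one_add_norm_sq (E := ℝ) (μ := volume) (r := 2 * s.re)
    (by simp; linarith)
  refine h.mono' ?_ (.of_forall fun t => ?_)
  · exact Measurable.aestronglyMeasurable (by fun_prop)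
  · rw [Complex.norm_cpow_eq_rpow_re_of_pos (by positivity)]
    simp only [Real.norm_eq_abs, sq_abs, Complex.neg_re]
    apply le_of_eq; congr 1; ring

theorem integral_one_add_sq_cpow_neg {s : ℂ} (hs : 1 / 2 < s.re) :
    ∫ t : ℝ, ((1 + t ^ 2 : ℝ) : ℂ) ^ (-s) =
      (Real.pi : ℂ) ^ (1 / 2 : ℂ) * Complex.Gamma (s - 1 / 2) / Complex.Gamma s := by
  have hs0 : 0 < s.re := by linarith
  have hG : Complex.Gamma s ≠ 0 := Complex.Gamma_ne_zero_of_re_pos hs0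
  rw [eq_div_iff hG, ← integral_mul_const]
  let F : ℝ → ℝ → ℂ := fun t u => (u : ℂ) ^ (s - 1) * Complex.exp (-(((1 + t ^ 2 : ℝ) : ℂ) * u))
  have hq (t : ℝ) : 0 < 1 + t ^ 2 := by positivity
  have key (t : ℝ) : ((1 + t ^ 2 : ℝ) : ℂ) ^ (-s) * Complex.Gamma s =
      ∫ u in Set.Ioi (0 : ℝ), F t u := by
    rw [Complex.integral_cpow_mul_exp_neg_mul_Ioi hs0 (by simpa using hq t), one_div,
      Complex.inv_cpow _ _ (by
        rw [Complex.arg_ofReal_of_nonneg (hq t).le]; exact Real.pi_pos.ne), Complex.cpow_neg]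
  have hnorm (t u : ℝ) (hu : 0 < u) :
      ‖F t u‖ = Real.exp (-u * t ^ 2) * (Real.exp (-u) * u ^ (s.re - 1)) := by
    simp only [F]
    rw [norm_mul, Complex.norm_cpow_eq_rpow_re_of_pos hu, Complex.norm_exp, ← mul_assoc,
      ← Real.exp_add, mul_comm]
    congr 2
    · rw [Complex.neg_re, ← Complex.ofReal_mul, Complex.ofReal_re]; ring
  have hmeas : AEStronglyMeasurable (Function.uncurry F)
      (volume.prod (volume.restrict (Set.Ioi 0))) := by
    apply Measurable.aestronglyMeasurable
    simp only [F, Function.uncurry_def]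
    fun_prop
  have hint : Integrable (Function.uncurry F) (volume.prod (volume.restrict (Set.Ioi 0))) := by
    rw [integrable_prod_iff' hmeas]
    constructor
    · refine (ae_restrict_iff' measurableSet_Ioi).2 (.of_forall fun u hu => ?_)
      refine ((integrable_exp_neg_mul_sq hu).mul_const
        (Real.exp (-u) * u ^ (s.re - 1))).mono' ?_ (.of_forall fun t => (hnorm t u hu).le)
      exact Measurable.aestronglyMeasurable (by simp only [F, Function.uncurry_def]; fun_prop)
    · have h := (Real.GammaIntegral_convergent (s := s.re - 1 / 2) (by linarith)).const_mul
        √Real.pi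
      refine IntegrableOn.congr_fun h (fun u hu => ?_) measurableSet_Ioi
      have hu : 0 < u := hu
      simp only [Function.uncurry_apply_pair, hnorm _ u hu]
      rw [integral_mul_const, integral_gaussian, Real.sqrt_div' _ hu.le,
        show s.re - 1 / 2 - 1 = (s.re - 1) - 1 / 2 by ring, Real.rpow_sub hu,
        Real.sqrt_eq_rpow u]
      ring
  simp_rw [key]
  rw [integral_integral_swap hint]
  have hin (u : ℝ) (hu : u ∈ Set.Ioi (0 : ℝ)) : ∫ t, F t u = (Real.pi : ℂ) ^ (1 / 2 : ℂ) *
      ((u : ℂ) ^ (s - 1 / 2 - 1) * Complex.exp (-(1 * u))) := by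
    have hu : 0 < u := hu
    have hu' : (u : ℂ) ≠ 0 := by exact_mod_cast hu.ne'
    have h1 (t : ℝ) : F t u = ((u : ℂ) ^ (s - 1) * Complex.exp (-u)) *
        Complex.exp (-(u : ℂ) * (t : ℂ) ^ 2) := by
      simp only [F]
      rw [mul_assoc, ← Complex.exp_add]
      congr 2
      push_cast; ring
    simp_rw [h1]
    rw [integral_const_mul, integral_gaussian_complex (by simpa using hu),
      show s - 1 / 2 - 1 = (s - 1) - 1 / 2 by ring, Complex.cpow_sub _ (1 / 2) hu',
      div_eq_mul_inv (Real.pi : ℂ), ← Complex.ofReal_inv,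
      Complex.mul_cpow_ofReal_nonneg Real.pi_pos.le (by positivity), Complex.ofReal_inv,
      Complex.inv_cpow _ _ (by
        rw [Complex.arg_ofReal_of_nonneg hu.le]; exact Real.pi_pos.ne), one_mul]
    ring
  rw [setIntegral_congr_fun measurableSet_Ioi hin, integral_const_mul,
    Complex.Gamma_eq_integral (by simp at hs ⊢; linarith), Complex.GammaIntegral]
  congr 1
  refine setIntegral_congr_fun measurableSet_Ioi fun u _ => ?_
  simp [mul_comm]

theorem volume_sum_sq_lt {d : ℕ} (hd : 1 ≤ d) (R : ℝ) :
    volume {x : Fin d → ℝ | ∑ j, x j ^ 2 < R} =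
      ENNReal.ofReal (√R ^ d * (√Real.pi ^ d / Real.Gamma ((d : ℝ) / 2 + 1))) := by
  have : Nonempty (Fin d) := ⟨⟨0, hd⟩⟩
  have h := volume_sum_rpow_lt (Fin d) (p := 2) one_le_two √R
  have hset : {x : Fin d → ℝ | (∑ i, |x i| ^ (2 : ℝ)) ^ (1 / (2 : ℝ)) < √R} =
      {x : Fin d → ℝ | ∑ j, x j ^ 2 < R} := by
    ext x
    simp only [Set.mem_ofPred_eq, Real.rpow_two, sq_abs, ← Real.sqrt_eq_rpow]
    exact Real.sqrt_lt_sqrt_iff (by positivity)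
  rw [hset] at h
  rw [h, ← ENNReal.ofReal_pow (by positivity), ← ENNReal.ofReal_mul (by positivity),
    Fintype.card_fin, Real.Gamma_add_one (s := 1 / 2) (by norm_num), Real.Gamma_one_half_eq]
  congr 3
  ring

/-- The time-slice formula for the distribution function of the Gaussian weight. -/
theorem gaussDist_exp_neg {d : ℕ} (hd : 1 ≤ d) (k : ℝ) :
    gaussDist d (Real.exp (-k)) =
      ∫ t : ℝ, √(k - (d : ℝ) / 2 * Real.log (1 + t ^ 2)) ^ d *
        (√(2 * (1 + t ^ 2)) ^ d * (√Real.pi ^ d / Real.Gamma ((d : ℝ) / 2 + 1))) := by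
  have hG : 0 < Real.Gamma ((d : ℝ) / 2 + 1) := Real.Gamma_pos_of_pos (by positivity)
  rw [integral_eq_lintegral_of_nonneg_ae (.of_forall fun t => by
      simp only [Pi.zero_apply]; positivity)
    (Measurable.aestronglyMeasurable (by fun_prop)), gaussDist, Measure.volume_eq_prod,
    Measure.prod_apply]
  · congr 1
    refine lintegral_congr fun t => ?_
    have hq : 0 < 1 + t ^ 2 := by positivity
    have hset : Prod.mk t ⁻¹' {p : ℝ × (Fin d → ℝ) | Real.exp (-k) < gaussWeight d p} =
        {x | ∑ j, x j ^ 2 < (2 * (1 + t ^ 2)) * (k - (d : ℝ) / 2 * Real.log (1 + t ^ 2))} := by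
      ext x
      simp only [Set.mem_preimage, Set.mem_ofPred_eq, gaussWeight]
      rw [Real.rpow_def_of_pos hq, ← Real.exp_add, Real.exp_lt_exp, ← div_lt_iff₀' (by positivity),
        neg_div, neg_div]
      constructor <;> intro h <;> linarith
    rw [hset, volume_sum_sq_lt hd, Real.sqrt_mul (by positivity)]
    congr 1
    ring
  · apply measurableSet_lt measurable_const
    unfold gaussWeight
    fun_prop

theorem sqrt_pow_mul_exp_neg_log (d : ℕ) (z : ℂ) {q : ℝ} (hq : 0 < q) :
    ((√q ^ d : ℝ) : ℂ) * Complex.exp (-(((d : ℝ) / 2 * Real.log q : ℝ) : ℂ) * z) =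
      (q : ℂ) ^ (-((d : ℂ) / 2 * (z - 1))) := by
  have hq' : (q : ℂ) ≠ 0 := by exact_mod_cast hq.ne'
  rw [sqrt_pow_eq_rpow hq.le, Complex.ofReal_cpow hq.le, Complex.cpow_def_of_ne_zero hq',
    Complex.cpow_def_of_ne_zero hq', ← Complex.exp_add, ← Complex.ofReal_log hq.le]
  congr 1
  push_cast; ring

theorem setIntegral_exp_neg_mul_slice {d : ℕ} (hd : 1 ≤ d) {z : ℂ} (hz : 0 < z.re) (t : ℝ) :
    ∫ k in Set.Ioi (0 : ℝ), Complex.exp (-(k : ℂ) * z) *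
      ((√(k - (d : ℝ) / 2 * Real.log (1 + t ^ 2)) ^ d *
        (√(2 * (1 + t ^ 2)) ^ d * (√Real.pi ^ d / Real.Gamma ((d : ℝ) / 2 + 1))) : ℝ) : ℂ) =
      (2 : ℂ) ^ ((d : ℂ) / 2) * (Real.pi : ℂ) ^ ((d : ℂ) / 2) * z ^ (-(d : ℂ) / 2 - 1) *
        ((1 + t ^ 2 : ℝ) : ℂ) ^ (-((d : ℂ) / 2 * (z - 1))) := by
  have hq : 0 < 1 + t ^ 2 := by positivity
  have ha : 0 ≤ (d : ℝ) / 2 * Real.log (1 + t ^ 2) :=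
    mul_nonneg (by positivity) (Real.log_nonneg (by nlinarith [sq_nonneg t]))
  have hG : Complex.Gamma ((d : ℂ) / 2 + 1) ≠ 0 :=
    Complex.Gamma_ne_zero_of_re_pos (by simp; positivity)
  have hG' : ((Real.Gamma ((d : ℝ) / 2 + 1) : ℝ) : ℂ) = Complex.Gamma ((d : ℂ) / 2 + 1) := by
    rw [← Complex.Gamma_ofReal]; push_cast; rfl
  have h2 : ((√2 ^ d : ℝ) : ℂ) = (2 : ℂ) ^ ((d : ℂ) / 2) := by
    rw [sqrt_pow_eq_rpow zero_le_two, Complex.ofReal_cpow zero_le_two]; push_cast; rfl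
  have hpi : ((√Real.pi ^ d : ℝ) : ℂ) = (Real.pi : ℂ) ^ ((d : ℂ) / 2) := by
    rw [sqrt_pow_eq_rpow Real.pi_pos.le, Complex.ofReal_cpow Real.pi_pos.le]; push_cast; rfl
  simp_rw [Complex.ofReal_mul (√(_ - _) ^ d), ← mul_assoc]
  rw [integral_mul_const, setIntegral_exp_neg_mul_sqrt_sub_pow hd hz ha,
    ← sqrt_pow_mul_exp_neg_log d z hq, Real.sqrt_mul zero_le_two, mul_pow, Complex.ofReal_mul,
    Complex.ofReal_mul, Complex.ofReal_mul (√2 ^ d), Complex.ofReal_div (√Real.pi ^ d), hG', h2,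
    hpi]
  generalize Complex.Gamma ((d : ℂ) / 2 + 1) = G at hG
  field_simp

theorem half_lt_re_half_mul_sub_one {d : ℕ} (hd : 1 ≤ d) {z : ℂ}
    (hz : 1 + 1 / (d : ℝ) < z.re) : 1 / 2 < ((d : ℂ) / 2 * (z - 1)).re := by
  have hd0 : (0 : ℝ) < d := by exact_mod_cast hd
  have h : ((d : ℂ) / 2 * (z - 1)).re = (d : ℝ) / 2 * (z.re - 1) := by
    rw [show (d : ℂ) / 2 = ((d / 2 : ℝ) : ℂ) by push_cast; rfl, Complex.re_ofReal_mul]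
    simp
  have h' : d * (1 / (d : ℝ)) < d * (z.re - 1) := by gcongr; linarith
  rw [mul_one_div_cancel hd0.ne'] at h'
  linarith

theorem integrable_exp_neg_mul_slices {d : ℕ} (hd : 1 ≤ d) {z : ℂ}
    (hz : 1 + 1 / (d : ℝ) < z.re) :
    Integrable (Function.uncurry fun k t : ℝ => Complex.exp (-(k : ℂ) * z) *
      ((√(k - (d : ℝ) / 2 * Real.log (1 + t ^ 2)) ^ d *
        (√(2 * (1 + t ^ 2)) ^ d * (√Real.pi ^ d / Real.Gamma ((d : ℝ) / 2 + 1))) : ℝ) : ℂ))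
      ((volume.restrict (Set.Ioi 0)).prod volume) := by
  have hd0 : (0 : ℝ) < d := by exact_mod_cast hd
  have hz0 : 0 < z.re := lt_trans (by positivity) hz
  have hG : 0 < Real.Gamma ((d : ℝ) / 2 + 1) := Real.Gamma_pos_of_pos (by positivity)
  rw [integrable_prod_iff' (Measurable.aestronglyMeasurable (by
    simp only [Function.uncurry_def]; fun_prop))]
  constructor
  · refine .of_forall fun t => ?_
    simp_rw [Function.uncurry_apply_pair, Complex.ofReal_mul (√(_ - _) ^ d), ← mul_assoc]
    exact ((integrable_exp_neg_mul_sqrt_sub_pow hd hz0 _).mul_const _).integrableOn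
  · have hs := half_lt_re_half_mul_sub_one hd (z := (z.re : ℂ)) (by simpa using hz)
    have h := (integrable_one_add_sq_cpow_neg hs).const_mul
      ((2 : ℂ) ^ ((d : ℂ) / 2) * (Real.pi : ℂ) ^ ((d : ℂ) / 2) *
        (z.re : ℂ) ^ (-(d : ℂ) / 2 - 1))
    simp_rw [← setIntegral_exp_neg_mul_slice hd (z := (z.re : ℂ)) (by simpa using hz0)] at h
    refine h.re.congr (.of_forall fun t => ?_)
    simp only [Function.uncurry_apply_pair]
    rw [← RCLike.ofReal_re (K := ℂ) (∫ _ in _, _), ← integral_ofReal]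
    congr 2
    funext k
    rw [norm_mul, Complex.norm_exp, Complex.norm_real, Real.norm_of_nonneg (by positivity)]
    push_cast
    simp

/-- For `Re z > 1 + 1/d`, the integral defining `M(z)` converges
absolutely and `M(z) = 2^{d/2} π^{(d+1)/2} z^{-d/2-1} Γ((d/2)(z-1)-1/2)/Γ((d/2)(z-1))`. -/
theorem M_eq_gamma_formula (d : ℕ) (hd : 1 ≤ d) (z : ℂ)
    (hz : 1 + 1 / (d : ℝ) < z.re) :
    IntegrableOn
      (fun k : ℝ => Complex.exp (-(k : ℂ) * z) * (gaussDist d (Real.exp (-k)) : ℂ))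
      (Set.Ioi 0) ∧
    M d z = (2 : ℂ) ^ ((d : ℂ) / 2) * (Real.pi : ℂ) ^ (((d : ℂ) + 1) / 2) *
      z ^ (-(d : ℂ) / 2 - 1) *
      Complex.Gamma ((d : ℂ) / 2 * (z - 1) - 1 / 2) /
      Complex.Gamma ((d : ℂ) / 2 * (z - 1)) := by
  have hd0 : (0 : ℝ) < d := by exact_mod_cast hd
  have hz0 : 0 < z.re := lt_trans (by positivity) hz
  have hs : 1 / 2 < ((d : ℂ) / 2 * (z - 1)).re := half_lt_re_half_mul_sub_one hd hz
  have hint := integrable_exp_neg_mul_slices hd hz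
  have hM (k : ℝ) := gaussDist_exp_neg hd k
  unfold M
  simp_rw [hM, ← integral_complex_ofReal, ← integral_const_mul]
  refine ⟨hint.integral_prod_left, ?_⟩
  rw [integral_integral_swap hint]
  simp_rw [setIntegral_exp_neg_mul_slice hd hz0]
  rw [integral_const_mul, integral_one_add_sq_cpow_neg hs, add_div,
    Complex.cpow_add _ _ (by exact_mod_cast Real.pi_ne_zero)]
  ring
end

section
/- For every c ∈ ℂ with Re c > 1/2, the function t ↦ (1+t²)^{-c} is integrable on ℝ and ∫_ℝ (1+t²)^{-c} dt = √π · Γ(c - 1/2) / Γ(c), where (1+t²)^{-c} = exp(-c·log(1+t²)) is the complex power of the positive real number 1+t² and Γ denotes the complex Gamma function. -/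
open MeasureTheory

lemma inv_one_add_sq_image_Ioi :
    (fun t : ℝ => (1 + t ^ 2)⁻¹) '' Set.Ioi 0 = Set.Ioo 0 1 := by
  ext s
  constructor
  · rintro ⟨t, ht, rfl⟩
    have ht : 0 < t := ht
    exact ⟨by positivity, inv_lt_one_of_one_lt₀ (by nlinarith)⟩
  · rintro ⟨h0, h1⟩
    have h : 0 < s⁻¹ - 1 := sub_pos.2 ((one_lt_inv₀ h0).2 h1)
    refine ⟨√(s⁻¹ - 1), Real.sqrt_pos.2 h, ?_⟩
    simp [Real.sq_sqrt h.le]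

lemma inv_one_add_sq_injOn_Ioi : Set.InjOn (fun t : ℝ => (1 + t ^ 2)⁻¹) (Set.Ioi 0) := by
  intro x hx y hy h
  have h' : x ^ 2 = y ^ 2 := add_left_cancel (inv_injective h)
  exact (pow_left_inj₀ (le_of_lt hx) (le_of_lt hy) two_ne_zero).1 h'

lemma hasDerivAt_inv_one_add_sq (t : ℝ) :
    HasDerivAt (fun t : ℝ => (1 + t ^ 2)⁻¹) (-(2 * t) / (1 + t ^ 2) ^ 2) t := by
  have h : HasDerivAt (fun t : ℝ => 1 + t ^ 2) (2 * t) t := by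
    simpa using (hasDerivAt_pow 2 t).const_add 1
  exact h.fun_inv (by positivity)

/-- The integrand of the Beta integral with second parameter `1 / 2`, pulled back along
`t ↦ (1 + t²)⁻¹`. -/
lemma abs_deriv_smul_beta_integrand (c : ℂ) {t : ℝ} (ht : 0 < t) :
    |-(2 * t) / (1 + t ^ 2) ^ 2| • ((((1 + t ^ 2)⁻¹ : ℝ) : ℂ) ^ (c - 1 / 2 - 1) *
      (1 - (((1 + t ^ 2)⁻¹ : ℝ) : ℂ)) ^ ((1 / 2 : ℂ) - 1)) =
      2 * ((1 + t ^ 2 : ℝ) : ℂ) ^ (-c) := by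
  have hA : 0 < 1 + t ^ 2 := by positivity
  have hs : 1 - (1 + t ^ 2)⁻¹ = t ^ 2 / (1 + t ^ 2) := by field_simp; ring
  have hlog : Real.log (t ^ 2 / (1 + t ^ 2)) = 2 * Real.log t - Real.log (1 + t ^ 2) := by
    rw [Real.log_div (by positivity) hA.ne', Real.log_pow]
    norm_num
  have habs : |-(2 * t) / (1 + t ^ 2) ^ 2| =
      2 * Real.exp (Real.log t - 2 * Real.log (1 + t ^ 2)) := by
    rw [neg_div, abs_neg, abs_of_pos (by positivity), Real.exp_sub, two_mul (Real.log _),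
      Real.exp_add, Real.exp_log ht, Real.exp_log hA]
    ring
  have hcpow {x : ℝ} (hx : 0 < x) (z : ℂ) : (x : ℂ) ^ z = Complex.exp (Real.log x * z) := by
    rw [Complex.cpow_def_of_ne_zero (by exact_mod_cast hx.ne'), Complex.ofReal_log hx.le]
  rw [← Complex.ofReal_one, ← Complex.ofReal_sub, hs, Complex.ofReal_one, habs,
    hcpow (inv_pos.2 hA), hcpow (div_pos (pow_pos ht 2) hA), hcpow hA, hlog, Real.log_inv,
    Complex.real_smul]
  push_cast
  rw [mul_assoc, ← Complex.exp_add, ← Complex.exp_add]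
  congr 2
  ring

lemma integrable_one_add_sq_cpow {c : ℂ} (hc : 1 / 2 < c.re) :
    Integrable (fun t : ℝ => ((1 + t ^ 2 : ℝ) : ℂ) ^ (-c)) := by
  have h := integrable_rpow_neg_one_add_norm_sq (E := ℝ) (μ := volume) (r := 2 * c.re)
    (by simp; linarith)
  refine h.mono' ?_ (Filter.Eventually.of_forall fun t => ?_)
  · exact Measurable.aestronglyMeasurable (by fun_prop)
  · rw [Complex.norm_cpow_eq_rpow_re_of_pos (by positivity), Real.norm_eq_abs, sq_abs]
    apply le_of_eq
    congr 1
    simp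
    ring

lemma two_mul_integral_Ioi_one_add_sq_cpow (c : ℂ) :
    2 * ∫ t in Set.Ioi (0 : ℝ), ((1 + t ^ 2 : ℝ) : ℂ) ^ (-c) =
      Complex.betaIntegral (c - 1 / 2) (1 / 2) := by
  rw [Complex.betaIntegral, intervalIntegral.integral_of_le zero_le_one,
    integral_Ioc_eq_integral_Ioo, ← inv_one_add_sq_image_Ioi,
    integral_image_eq_integral_abs_deriv_smul measurableSet_Ioi
      (fun t _ => (hasDerivAt_inv_one_add_sq t).hasDerivWithinAt) inv_one_add_sq_injOn_Ioi,
    setIntegral_congr_fun measurableSet_Ioi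
      (fun t ht => abs_deriv_smul_beta_integrand c ht), integral_const_mul]

/-- For `Re c > 1/2`, `t ↦ (1+t²)^{-c}` is integrable on `ℝ` and
`∫_ℝ (1+t²)^{-c} dt = √π Γ(c - 1/2)/Γ(c)`. -/
theorem integral_one_add_sq_cpow (c : ℂ) (hc : 1 / 2 < c.re) :
    Integrable (fun t : ℝ => ((1 + t ^ 2 : ℝ) : ℂ) ^ (-c)) ∧
    ∫ t : ℝ, ((1 + t ^ 2 : ℝ) : ℂ) ^ (-c) =
      (Real.sqrt Real.pi : ℂ) * Complex.Gamma (c - 1 / 2) / Complex.Gamma c := by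
  have hint := integrable_one_add_sq_cpow hc
  refine ⟨hint, ?_⟩
  have heven : ∫ t in Set.Iic (0 : ℝ), ((1 + t ^ 2 : ℝ) : ℂ) ^ (-c) =
      ∫ t in Set.Ioi (0 : ℝ), ((1 + t ^ 2 : ℝ) : ℂ) ^ (-c) := by
    rw [← neg_zero, ← integral_comp_neg_Iic, neg_zero]
    simp only [neg_sq]
  have hsqrt : (Real.sqrt Real.pi : ℂ) = Complex.Gamma (1 / 2) := by
    rw [← Real.Gamma_one_half_eq, ← Complex.Gamma_ofReal]
    norm_num
  rw [← intervalIntegral.integral_Iic_add_Ioi hint.integrableOn hint.integrableOn, heven,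
    ← two_mul, two_mul_integral_Ioi_one_add_sq_cpow,
    Complex.betaIntegral_eq_Gamma_mul_div _ _ (by simpa using hc) (by norm_num), hsqrt,
    sub_add_cancel, mul_comm (Complex.Gamma (1 / 2))]
end

section
/- For every real c ≥ 1 + 3/(2d), the function v(k) = e^{-ck} μ(e^{-k}) is square-integrable on [0,∞), i.e. ∫₀^∞ (e^{-ck} μ(e^{-k}))² dk < ∞. -/
open MeasureTheory
open scoped BigOperators

theorem gaussWeight_superlevel_subset {d : ℕ} (hd : 1 ≤ d) {k : ℝ} (hk : 0 ≤ k) :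
    {p : ℝ × (Fin d → ℝ) | Real.exp (-k) < gaussWeight d p} ⊆
      Set.Icc (-Real.exp (k / d)) (Real.exp (k / d)) ×ˢ
        Set.Icc (fun _ => -(√(2 * k) * Real.exp (k / d)))
          (fun _ => √(2 * k) * Real.exp (k / d)) := by
  rintro ⟨t, x⟩ h
  simp only [Set.mem_ofPred_eq, gaussWeight] at h
  have hd0 : (0 : ℝ) < d := by exact_mod_cast hd
  have hs : 1 ≤ 1 + t ^ 2 := by nlinarith [sq_nonneg t]
  have hs0 : 0 < 1 + t ^ 2 := by linarith
  have hsum : 0 ≤ ∑ j, x j ^ 2 := Finset.sum_nonneg fun j _ => sq_nonneg _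
  have hexp : Real.exp (-(∑ j, x j ^ 2) / (2 * (1 + t ^ 2))) ≤ 1 := by
    rw [Real.exp_le_one_iff, neg_div]
    have : 0 ≤ (∑ j, x j ^ 2) / (2 * (1 + t ^ 2)) := by positivity
    linarith
  have hpow : (1 + t ^ 2) ^ (-(d : ℝ) / 2) ≤ 1 :=
    Real.rpow_le_one_of_one_le_of_nonpos hs (by linarith)
  have hpow0 : 0 < (1 + t ^ 2) ^ (-(d : ℝ) / 2) := Real.rpow_pos_of_pos hs0 _
  have h1 : Real.exp (-k) < (1 + t ^ 2) ^ (-(d : ℝ) / 2) :=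
    h.trans_le (mul_le_of_le_one_right hpow0.le hexp)
  have h2 : Real.exp (-k) < Real.exp (-(∑ j, x j ^ 2) / (2 * (1 + t ^ 2))) :=
    h.trans_le (mul_le_of_le_one_left (Real.exp_pos _).le hpow)
  rw [Real.rpow_def_of_pos hs0, Real.exp_lt_exp] at h1
  rw [Real.exp_lt_exp, lt_div_iff₀ (by positivity)] at h2
  have hlog : Real.log (1 + t ^ 2) ≤ k / d + k / d := by
    rw [← add_div, le_div_iff₀ hd0]
    linarith
  have hsE : 1 + t ^ 2 ≤ Real.exp (k / d) ^ 2 := by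
    rw [Real.log_le_iff_le_exp hs0, Real.exp_add] at hlog
    linarith [sq (Real.exp (k / d))]
  refine ⟨?_, ?_⟩
  · exact abs_le.1 (abs_le_of_sq_le_sq (by linarith) (Real.exp_pos _).le)
  · have hx (j : Fin d) : |x j| ≤ √(2 * k) * Real.exp (k / d) := by
      refine abs_le_of_sq_le_sq ?_ (by positivity)
      rw [mul_pow, Real.sq_sqrt (by linarith)]
      have : x j ^ 2 ≤ ∑ j, x j ^ 2 :=
        Finset.single_le_sum (fun j _ => sq_nonneg (x j)) (Finset.mem_univ j)
      nlinarith [mul_le_mul_of_nonneg_left hsE hk]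
    exact ⟨fun j => (abs_le.1 (hx j)).1, fun j => (abs_le.1 (hx j)).2⟩

theorem gaussDist_exp_neg_le {d : ℕ} (hd : 1 ≤ d) {k : ℝ} (hk : 0 ≤ k) :
    gaussDist d (Real.exp (-k)) ≤
      2 * Real.exp (k / d) * (2 * (√(2 * k) * Real.exp (k / d))) ^ d := by
  refine ENNReal.toReal_le_of_le_ofReal (by positivity)
    ((measure_mono (gaussWeight_superlevel_subset hd hk)).trans_eq ?_)
  rw [Measure.volume_eq_prod, Measure.prod_prod, Real.volume_Icc, Real.volume_Icc_pi,
    Finset.prod_const, Finset.card_univ, Fintype.card_fin, ← ENNReal.ofReal_pow (by simp; positivity),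
    ← ENNReal.ofReal_mul (by linarith [Real.exp_pos (k / d)])]
  congr 1
  ring

theorem measurable_gaussDist (d : ℕ) : Measurable (gaussDist d) := by
  have : Antitone fun l : ℝ => volume {p : ℝ × (Fin d → ℝ) | l < gaussWeight d p} :=
    fun _ _ hab => measure_mono fun _ hp => lt_of_le_of_lt hab hp
  exact this.measurable.ennreal_toReal

/-- For every real `c ≥ 1 + 3/(2d)`, the function
`v(k) = e^{-ck} μ(e^{-k})` is square-integrable on `[0,∞)`. -/
theorem v_square_integrable (d : ℕ) (hd : 1 ≤ d) (c : ℝ)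
    (hc : 1 + 3 / (2 * (d : ℝ)) ≤ c) :
    IntegrableOn
      (fun k : ℝ => (Real.exp (-(c * k)) * gaussDist d (Real.exp (-k))) ^ 2)
      (Set.Ici 0) := by
  have hd0 : (0 : ℝ) < d := by exact_mod_cast hd
  rw [integrableOn_Ici_iff_integrableOn_Ioi]
  have hint : IntegrableOn (fun k : ℝ => (4 * 4 ^ d * 2 ^ d) *
      (k ^ (d : ℝ) * Real.exp (-(1 / d) * k ^ (1 : ℝ)))) (Set.Ioi 0) :=
    (integrableOn_rpow_mul_exp_neg_mul_rpow (by linarith) one_pos (by positivity)).const_mul _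
  refine hint.mono' ?_ ?_
  · have := measurable_gaussDist d
    exact Measurable.aestronglyMeasurable (by fun_prop)
  · refine (ae_restrict_iff' measurableSet_Ioi).2 (.of_forall fun k hk => ?_)
    have hk0 : 0 ≤ k := le_of_lt hk
    rw [Real.norm_of_nonneg (sq_nonneg _), Real.rpow_natCast, Real.rpow_one]
    have hμ : 0 ≤ gaussDist d (Real.exp (-k)) := ENNReal.toReal_nonneg
    have hE : Real.exp (k / d) ^ d = Real.exp k := by
      rw [← Real.exp_nat_mul, mul_div_cancel₀ _ hd0.ne']
    have hroot : (√(2 * k) ^ d) ^ 2 = 2 ^ d * k ^ d := by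
      rw [← pow_mul, mul_comm d, pow_mul, Real.sq_sqrt (by linarith), mul_pow]
    have hfour : ((2 : ℝ) ^ d) ^ 2 = 4 ^ d := by
      rw [← pow_mul, mul_comm d, pow_mul]
      norm_num
    have hdecay : (Real.exp (-(c * k)) * Real.exp (k / d) * Real.exp k) ^ 2 ≤
        Real.exp (-(1 / d) * k) := by
      rw [← Real.exp_add, ← Real.exp_add, ← Real.exp_nat_mul, Real.exp_le_exp]
      have hck := mul_le_mul_of_nonneg_right hc hk0
      have : (1 + 3 / (2 * (d : ℝ))) * k = k + 3 / 2 * (k / d) := by field_simp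
      have : -(1 / (d : ℝ)) * k = -(k / d) := by ring
      push_cast
      linarith
    calc (Real.exp (-(c * k)) * gaussDist d (Real.exp (-k))) ^ 2
        ≤ (Real.exp (-(c * k)) *
            (2 * Real.exp (k / d) * (2 * (√(2 * k) * Real.exp (k / d))) ^ d)) ^ 2 := by
          gcongr
          exact gaussDist_exp_neg_le hd hk0
      _ = 4 * (2 ^ d) ^ 2 * (√(2 * k) ^ d) ^ 2 *
            (Real.exp (-(c * k)) * Real.exp (k / d) * Real.exp k) ^ 2 := by
          rw [mul_pow 2, mul_pow √(2 * k), hE]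
          ring
      _ ≤ 4 * (2 ^ d) ^ 2 * (√(2 * k) ^ d) ^ 2 * Real.exp (-(1 / d) * k) := by gcongr
      _ = 4 * 4 ^ d * 2 ^ d * (k ^ d * Real.exp (-(1 / d) * k)) := by
          rw [hroot, hfour]
          ring
end
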